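/- arXiv:1909.00838 — 2 statements merged into one kernel-verified Lean document; each statement's English description precedes it below -/
import Mathlib

section
/- Let X be a real 2n×2n matrix with det X ≠ 0. Then there exists a real symmetric matrix R (Rᵀ = R) and a real symplectic matrix S (S·J·Sᵀ = J) such that X = R·D·S, where D is the block diagonal matrix D = [[Iₙ, 0], [0, -Iₙ]]. -/
open Matrix

/-- The standard symplectic form matrix `J = [[0, -I_n], [I_n, 0]]`. -/
def symplJ (n : ℕ) : Matrix (Fin n ⊕ Fin n) (Fin n ⊕ Fin n) ℝ :=
  Matrix.fromBlocks 0 (-1) 1 0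

/-- The block diagonal matrix `D = [[I_n, 0], [0, -I_n]]`. -/
def Dmat (n : ℕ) : Matrix (Fin n ⊕ Fin n) (Fin n ⊕ Fin n) ℝ :=
  Matrix.fromBlocks 1 0 0 (-1)

open Polynomial in
/-- Some vector is annihilated only by those polynomials in `N` that vanish. -/
theorem exists_aeval_apply_eq_zero_imp {k V : Type*} [Field k] [AddCommGroup V] [Module k V]
    [FiniteDimensional k V] (N : Module.End k V) :
    ∃ x : V, ∀ p : k[X], aeval N p x = 0 → aeval N p = 0 := by
  have : Module.Finite k[X] (Module.AEval' N) := inferInstance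
  obtain ⟨x, hx⟩ := Module.exists_ker_toSpanSingleton_eq_annihilator k[X] (Module.AEval' N)
  obtain ⟨x, rfl⟩ := (Module.AEval'.of N).surjective x
  refine ⟨x, fun p hp => ?_⟩
  have h : p ∈ Module.annihilator k[X] (Module.AEval' N) := by
    rw [← hx, LinearMap.mem_ker, LinearMap.toSpanSingleton_apply]
    erw [← Module.AEval.of_aeval_smul]
    simp [hp]
  rw [Module.mem_annihilator] at h
  ext v
  have hv := h (Module.AEval'.of N v)
  erw [← Module.AEval.of_aeval_smul] at hv
  simpa using hv

theorem LinearMap.exists_comp_eq_of_ker_le {k M V U : Type*} [Field k] [AddCommGroup M]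
    [Module k M] [AddCommGroup V] [Module k V] [AddCommGroup U] [Module k U]
    (f : M →ₗ[k] V) (g : M →ₗ[k] U) (h : ∀ z, f z = 0 → g z = 0) :
    ∃ l : V →ₗ[k] U, ∀ z, l (f z) = g z := by
  obtain ⟨s, hs⟩ := f.rangeRestrict.exists_rightInverse_of_surjective f.range_rangeRestrict
  obtain ⟨l, hl⟩ := (g.comp s).exists_extend
  refine ⟨l, fun z => ?_⟩
  have h1 : l (f z) = g (s (f.rangeRestrict z)) := LinearMap.congr_fun hl (f.rangeRestrict z)
  have h2 : f (s (f.rangeRestrict z)) = f z :=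
    congrArg Subtype.val (LinearMap.congr_fun hs (f.rangeRestrict z))
  rw [h1, ← sub_eq_zero, ← map_sub]
  exact h _ (by rw [map_sub, h2, sub_self])

open Polynomial in
/-- If `x` is annihilated only by the polynomials in `N` that vanish, then some linear functional
vanishes on no nonzero invariant subspace of the cyclic subspace generated by `x`. -/
theorem exists_dual_cyclic {k V : Type*} [Field k] [AddCommGroup V] [Module k V]
    [FiniteDimensional k V] (N : Module.End k V) (x : V)
    (hx : ∀ p : k[X], aeval N p x = 0 → aeval N p = 0) :
    ∃ l : V →ₗ[k] k, ∀ q : k[X], (∀ r : k[X], l (aeval N (r * q) x) = 0) → aeval N q = 0 := by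
  set m := minpoly k N
  have hm : m.Monic := minpoly.monic (Algebra.IsIntegral.isIntegral N)
  have hm0 : aeval N m = 0 := minpoly.aeval k N
  let f : k[X] →ₗ[k] V := (LinearMap.applyₗ x).comp (aeval N).toLinearMap
  obtain ⟨l, hl⟩ := f.exists_comp_eq_of_ker_le
    ((lcoeff k (m.natDegree - 1)).comp (modByMonicHom m)) (by
      intro p hp
      have : m ∣ p := minpoly.dvd k N (hx p hp)
      simp [(modByMonic_eq_zero_iff_dvd hm).2 this])
  have hl' : ∀ p : k[X], l (aeval N p x) = (p %ₘ m).coeff (m.natDegree - 1) := hl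
  refine ⟨l, fun q hq => ?_⟩
  by_contra hne
  have hq0 : q %ₘ m ≠ 0 := fun h => by
    obtain ⟨c, rfl⟩ := (modByMonic_eq_zero_iff_dvd hm).1 h
    exact hne (by rw [map_mul, hm0, zero_mul])
  have hm1 : m ≠ 1 := fun h => hq0 (by rw [h, modByMonic_one])
  have hdeg : (q %ₘ m).natDegree < m.natDegree := natDegree_modByMonic_lt q hm hm1
  set e := (q %ₘ m).natDegree
  have h := hq (X ^ (m.natDegree - 1 - e))
  have hmod : (X ^ (m.natDegree - 1 - e) * q) %ₘ m
      = X ^ (m.natDegree - 1 - e) * (q %ₘ m) := by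
    have h1 : (X ^ (m.natDegree - 1 - e) * (q %ₘ m)) %ₘ m
        = X ^ (m.natDegree - 1 - e) * (q %ₘ m) := by
      rw [modByMonic_eq_self_iff hm]
      apply degree_lt_degree
      rw [natDegree_X_pow_mul _ hq0]
      omega
    rw [← h1, ← sub_eq_zero, ← sub_modByMonic, ← mul_sub, modByMonic_eq_zero_iff_dvd hm]
    refine Dvd.dvd.mul_left ?_ _
    rw [← modByMonic_eq_zero_iff_dvd hm, sub_modByMonic, sub_eq_zero, eq_comm,
      modByMonic_eq_self_iff hm]
    exact degree_modByMonic_lt q hm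
  rw [hl', hmod] at h
  have h2 : m.natDegree - 1 = e + (m.natDegree - 1 - e) := by omega
  rw [coeff_X_pow_mul', if_pos (by omega), show m.natDegree - 1 - (m.natDegree - 1 - e) = e by omega]
    at h
  exact hq0 (leadingCoeff_eq_zero.1 h)

open Polynomial in
/-- An operator `N` for which `B u (N v)` is again an alternating form has a square root that is
skew-adjoint for the symplectic form `B`. -/
theorem LinearMap.BilinForm.exists_skewAdjoint_sqrt {k : Type*} [Field k] (n : ℕ) :
    ∀ {V : Type*} [AddCommGroup V] [Module k V] [FiniteDimensional k V],
      Module.finrank k V = n → ∀ (B : LinearMap.BilinForm k V), B.IsAlt → B.Nondegenerate →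
      ∀ N : Module.End k V, (∀ u v, B (N u) v = B u (N v)) → (∀ u, B u (N u) = 0) →
      ∃ H : Module.End k V, (∀ v, H (H v) = N v) ∧ ∀ u v, B (H u) v = -B u (H v) := by
  induction n using Nat.strong_induction_on with
  | _ n ih =>
  intro V _ _ _ hn B hB hnd N hN hNalt
  rcases subsingleton_or_nontrivial V with hV | hV
  · exact ⟨0, fun v => Subsingleton.elim _ _, by simp⟩
  have hneg : ∀ u v, B u v = -B v u := fun u v => (hB.neg_eq v u).symm
  have hadj : ∀ (p : k[X]) u v, B (aeval N p u) v = B u (aeval N p v) := by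
    intro p
    induction p using Polynomial.induction_on' with
    | add p q hp hq => intro u v; simp [hp, hq]
    | monomial i a =>
      intro u v
      have : ∀ (i : ℕ) u v, B ((N ^ i) u) v = B u ((N ^ i) v) := by
        intro i
        induction i with
        | zero => simp
        | succ i ihi =>
          intro u v
          rw [pow_succ, Module.End.mul_apply, ihi, hN, ← Module.End.mul_apply, ← pow_succ',
            pow_succ]
      simp [aeval_monomial, this]
  have halt : ∀ (p : k[X]) u, B u (aeval N p u) = 0 := by
    intro p u
    induction p using Polynomial.induction_on' with
    | add p q hp hq => simp [hp, hq]
    | monomial i a =>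
      have h : B u ((N ^ i) u) = 0 := by
        have hpow : ∀ (j : ℕ) u v, B u ((N ^ j) v) = B ((N ^ j) u) v := fun j u v => by
          simpa using (hadj (X ^ j) u v).symm
        rcases Nat.even_or_odd' i with ⟨j, rfl | rfl⟩
        · rw [two_mul, pow_add, Module.End.mul_apply, hpow]; exact hB _
        · rw [show 2 * j + 1 = j + (j + 1) by ring, pow_add, Module.End.mul_apply, hpow,
            pow_succ', Module.End.mul_apply]; exact hNalt _
      simp [aeval_monomial, h]
  obtain ⟨x, hx⟩ := exists_aeval_apply_eq_zero_imp N
  obtain ⟨l, hl⟩ := exists_dual_cyclic N x hx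
  obtain ⟨y, hy⟩ : ∃ y, ∀ v, B v y = l v :=
    ⟨-(B.toDual hnd).symm l, fun v => by
      rw [hneg, map_neg, LinearMap.neg_apply, neg_neg, LinearMap.BilinForm.apply_toDual_symm_apply]⟩
  have hxy : ∀ q : k[X], (∀ r : k[X], B (aeval N r x) (aeval N q y) = 0) → aeval N q = 0 :=
    fun q h => hl q fun r => by
      rw [← hy, mul_comm, map_mul, Module.End.mul_apply, hadj, h]
  have hxx : ∀ p q : k[X], B (aeval N p x) (aeval N q x) = 0 := fun p q => by
    rw [hadj, ← Module.End.mul_apply, ← map_mul, halt]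
  have hyy : ∀ p q : k[X], B (aeval N p y) (aeval N q y) = 0 := fun p q => by
    rw [hadj, ← Module.End.mul_apply, ← map_mul, halt]
  have hxy' : ∀ a b : k[X], B (aeval N a x) (aeval N b y) = B x (aeval N (a * b) y) := fun a b => by
    rw [hadj, ← Module.End.mul_apply, ← map_mul]
  have hyx : ∀ a b : k[X], B (aeval N a y) (aeval N b x) = -B x (aeval N (a * b) y) :=
    fun a b => by rw [hneg, hxy', mul_comm]
  let Φ : k[X] × k[X] →ₗ[k] V :=
    ((LinearMap.applyₗ x).comp (aeval N).toLinearMap).coprod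
      ((LinearMap.applyₗ y).comp (aeval N).toLinearMap)
  have hΦ : ∀ p q, Φ (p, q) = aeval N p x + aeval N q y := fun p q => by simp [Φ]
  have hker : ∀ p q : k[X], (∀ r s, B (Φ (r, s)) (Φ (p, q)) = 0) →
      aeval N p = 0 ∧ aeval N q = 0 := by
    intro p q h
    have hq : aeval N q = 0 := hxy q fun r => by
      simpa [hΦ, hxx] using h r 0
    refine ⟨hxy p fun r => ?_, hq⟩
    have h1 := h 0 r
    simp only [hΦ, hq, map_zero, LinearMap.zero_apply, zero_add, add_zero] at h1
    rwa [hyx, neg_eq_zero, ← hxy'] at h1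
  let T : k[X] × k[X] →ₗ[k] k[X] × k[X] :=
    ((LinearMap.mulLeft k X).comp (LinearMap.snd k _ _)).prod (LinearMap.fst k _ _)
  obtain ⟨h, hh⟩ := Φ.exists_comp_eq_of_ker_le (Φ.comp T) (by
    rintro ⟨p, q⟩ h0
    obtain ⟨hp, hq⟩ := hker p q fun r s => by rw [h0, map_zero]
    simp [T, hΦ, hp, hq])
  have hh' : ∀ p q, h (Φ (p, q)) = Φ (X * q, p) := fun p q => hh (p, q)
  have hhh : ∀ z, h (h (Φ z)) = N (Φ z) := by
    rintro ⟨p, q⟩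
    rw [hh', hh']
    simp [hΦ]
  have hskew : ∀ z w, B (h (Φ z)) (Φ w) = -B (Φ z) (h (Φ w)) := by
    rintro ⟨p, q⟩ ⟨r, s⟩
    simp only [hh']
    simp only [hΦ, map_add, LinearMap.add_apply, hxx, hyy, hxy', hyx, zero_add, add_zero]
    rw [show X * q * s = q * (X * s) by ring]
    ring
  let W := LinearMap.range Φ
  let P := B.orthogonal W
  have hP : ∀ {v}, v ∈ P ↔ ∀ z, B (Φ z) v = 0 := fun {v} => by
    rw [LinearMap.BilinForm.mem_orthogonal_iff]
    exact ⟨fun hv z => hv _ ⟨z, rfl⟩, fun hv _ ⟨z, hz⟩ => hz ▸ hv z⟩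
  have hdisj : Disjoint W P := by
    rw [Submodule.disjoint_def]
    rintro _ ⟨⟨p, q⟩, rfl⟩ hv
    obtain ⟨hp, hq⟩ := hker p q fun r s => hP.1 hv _
    simp [hΦ, hp, hq]
  have hc : IsCompl W P := (LinearMap.BilinForm.isCompl_orthogonal_iff_disjoint hB.isRefl).2 hdisj
  have hNP : ∀ v ∈ P, N v ∈ P := fun v hv => hP.2 fun ⟨p, q⟩ => by
    rw [← hN]
    have : N (Φ (p, q)) = Φ (X * p, X * q) := by simp [hΦ]
    rw [this, hP.1 hv]
  have hlt : Module.finrank k P < n := by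
    rw [← hn]
    apply Submodule.finrank_lt
    intro htop
    have hx0 : x = 0 := (Submodule.disjoint_def.1 hdisj) x ⟨(1, 0), by simp [hΦ]⟩
      (by rw [htop]; trivial)
    have h1 := hx 1 (by simp [hx0])
    rw [map_one] at h1
    exact one_ne_zero h1
  have hWP : ∀ z, ∀ v ∈ P, B v (Φ z) = 0 := fun z v hv => by rw [hneg, hP.1 hv, neg_zero]
  have hdec : ∀ v, ∃ z, ∃ w : P, v = Φ z + w := fun v => by
    obtain ⟨_, ⟨z, rfl⟩, w, hw, rfl⟩ := Submodule.mem_sup.1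
      (show v ∈ W ⊔ P by rw [hc.sup_eq_top]; trivial)
    exact ⟨z, ⟨w, hw⟩, rfl⟩
  have hrefl : (B.restrict P).IsRefl := (show (B.restrict P).IsAlt from fun v => hB _).isRefl
  obtain ⟨H', hH', hskew'⟩ := ih _ hlt rfl (B.restrict P) (fun v => hB _)
    ((hrefl.nondegenerate_iff_separatingLeft).2 fun u hu => by
      apply Subtype.ext
      apply hnd.1 u
      intro v
      obtain ⟨z, w, rfl⟩ := hdec v
      rw [map_add, hWP z u u.2, zero_add]
      exact hu w)
    (N.restrict hNP) (fun u v => hN _ _) (fun u => hNalt _)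
  let H := LinearMap.ofIsCompl hc (h.comp W.subtype) (P.subtype.comp H')
  have hHW : ∀ z, H (Φ z) = h (Φ z) := fun z =>
    LinearMap.ofIsCompl_apply_left hc (⟨Φ z, z, rfl⟩ : W)
  have hHP : ∀ w : P, H w = H' w := fun w => LinearMap.ofIsCompl_apply_right hc w
  refine ⟨H, fun v => ?_, fun u v => ?_⟩
  · obtain ⟨z, w, rfl⟩ := hdec v
    have h1 : (H' (H' w) : V) = N w := congrArg Subtype.val (hH' w)
    rw [map_add, map_add, hHW, hHP, hHP, h1, hh, LinearMap.comp_apply, hHW, map_add, ← hhh, hh z,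
      LinearMap.comp_apply]
  · obtain ⟨z, w, rfl⟩ := hdec u
    obtain ⟨z', w', rfl⟩ := hdec v
    have h1 : B (H' w) w' = -B w (H' w') := hskew' w w'
    simp only [map_add, LinearMap.add_apply, hHW, hHP, hskew, h1]
    simp only [hh, LinearMap.comp_apply, hWP _ _ (Subtype.property _), hP.1 (Subtype.property _)]
    ring

theorem symplJ_transpose (n : ℕ) : (symplJ n)ᵀ = -symplJ n := by
  simp [symplJ, fromBlocks_transpose, fromBlocks_neg]

theorem symplJ_mul_self (n : ℕ) : symplJ n * symplJ n = -1 := by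
  simp [symplJ, fromBlocks_multiply, ← fromBlocks_one, fromBlocks_neg]

theorem det_symplJ_ne_zero (n : ℕ) : (symplJ n).det ≠ 0 := by
  have h : IsUnit (symplJ n) :=
    IsUnit.of_mul_eq_one (-symplJ n) (by rw [mul_neg, symplJ_mul_self, neg_neg])
  exact ((isUnit_iff_isUnit_det _).1 h).ne_zero

theorem Dmat_mul_self (n : ℕ) : Dmat n * Dmat n = 1 := by
  simp [Dmat, fromBlocks_multiply]

theorem Dmat_transpose (n : ℕ) : (Dmat n)ᵀ = Dmat n := by
  simp [Dmat, fromBlocks_transpose]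

theorem Dmat_mul_symplJ_mul_Dmat (n : ℕ) : Dmat n * symplJ n * Dmat n = -symplJ n := by
  simp [Dmat, symplJ, fromBlocks_multiply, fromBlocks_neg]

/-- Every skew-symmetric matrix is of the form `R * J * R` with `R` symmetric. -/
theorem exists_symm_mul_symplJ_mul (n : ℕ) (K : Matrix (Fin n ⊕ Fin n) (Fin n ⊕ Fin n) ℝ)
    (hK : Kᵀ = -K) :
    ∃ R : Matrix (Fin n ⊕ Fin n) (Fin n ⊕ Fin n) ℝ, Rᵀ = R ∧ R * symplJ n * R = K := by
  have hJT := symplJ_transpose n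
  have hJJ := symplJ_mul_self n
  have hdet := det_symplJ_ne_zero n
  set J := symplJ n
  have hskew : ∀ A : Matrix (Fin n ⊕ Fin n) (Fin n ⊕ Fin n) ℝ, Aᵀ = -A → ∀ u, u ⬝ᵥ A *ᵥ u = 0 := by
    intro A hA u
    have h : u ⬝ᵥ A *ᵥ u = -(u ⬝ᵥ A *ᵥ u) := by
      conv_lhs => rw [dotProduct_mulVec, ← mulVec_transpose, hA, neg_mulVec, neg_dotProduct,
        dotProduct_comm]
    linarith
  have hB : ∀ u v, toBilin' J u v = u ⬝ᵥ J *ᵥ v := toBilin'_apply' J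
  have hadj : ∀ (A : Matrix (Fin n ⊕ Fin n) (Fin n ⊕ Fin n) ℝ) u v,
      (A *ᵥ u) ⬝ᵥ J *ᵥ v = u ⬝ᵥ (Aᵀ * J) *ᵥ v := fun A u v => by
    rw [← mulVec_mulVec, dotProduct_mulVec u, vecMul_transpose]
  obtain ⟨H, hH, hHs⟩ := LinearMap.BilinForm.exists_skewAdjoint_sqrt (k := ℝ) _ rfl (toBilin' J)
    (fun u => by rw [hB]; exact hskew J hJT u)
    (LinearMap.BilinForm.nondegenerate_toBilin'_of_det_ne_zero' J hdet)
    (toLin' (J * K))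
    (fun u v => by
      rw [hB, hB, toLin'_apply, toLin'_apply, hadj, mulVec_mulVec, transpose_mul,
        hJT, hK]
      congr 2
      rw [neg_mul_neg, ← mul_assoc, hJJ, mul_assoc, hJJ]
      simp)
    (fun u => by
      rw [hB, toLin'_apply, mulVec_mulVec, ← mul_assoc, hJJ]
      rw [neg_one_mul, neg_mulVec, dotProduct_neg, hskew K hK u, neg_zero])
  obtain ⟨A, rfl⟩ := toLin'.surjective H
  have hAA : A * A = J * K := by
    apply toLin'.injective
    rw [toLin'_mul]
    exact LinearMap.ext hH
  have hAJ : Aᵀ * J = -(J * A) := by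
    apply ext_of_mulVec_single
    intro j
    apply dotProduct_eq
    intro u
    have := hHs u (Pi.single j 1)
    rw [hB, hB, toLin'_apply, toLin'_apply, hadj, mulVec_mulVec] at this
    rw [dotProduct_comm, this, neg_mulVec, neg_dotProduct, dotProduct_comm]
  refine ⟨-(J * A), ?_, ?_⟩
  · rw [transpose_neg, transpose_mul, hJT, mul_neg, neg_neg, hAJ]
  · rw [neg_mul, neg_mul_neg, show J * A * J * (J * A) = J * A * (J * J) * A by simp only [mul_assoc],
      hJJ, mul_neg, mul_one, neg_mul, mul_assoc, hAA, ← mul_assoc, hJJ]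
    simp

/-- Corollary: a nondegenerate `X` factors as `X = R * D * S` with `R` symmetric and `S` symplectic. -/
theorem stmt_2 (n : ℕ) (X : Matrix (Fin n ⊕ Fin n) (Fin n ⊕ Fin n) ℝ)
    (hX : X.det ≠ 0) :
    ∃ R S : Matrix (Fin n ⊕ Fin n) (Fin n ⊕ Fin n) ℝ,
      Rᵀ = R ∧ S * symplJ n * Sᵀ = symplJ n ∧ X = R * Dmat n * S := by
  obtain ⟨R, hR, hRJ⟩ := exists_symm_mul_symplJ_mul n (-(X * symplJ n * Xᵀ)) (by
    rw [transpose_neg, transpose_mul, transpose_mul, transpose_transpose, symplJ_transpose,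
      neg_mul, mul_neg, mul_assoc])
  have hdet : IsUnit R.det := by
    have h := congrArg det hRJ
    rw [det_mul, det_mul, det_neg, det_mul, det_mul, det_transpose] at h
    refine isUnit_iff_ne_zero.2 fun h0 => ?_
    rw [h0, mul_zero] at h
    have : ((-1 : ℝ) ^ Fintype.card (Fin n ⊕ Fin n)) ≠ 0 := pow_ne_zero _ (by norm_num)
    exact mul_ne_zero this (mul_ne_zero (mul_ne_zero hX (det_symplJ_ne_zero n)) hX) h.symm
  have hXJ : X * symplJ n * Xᵀ = -(R * symplJ n * R) := by rw [hRJ, neg_neg]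
  refine ⟨R, Dmat n * R⁻¹ * X, hR, ?_, ?_⟩
  · calc Dmat n * R⁻¹ * X * symplJ n * (Dmat n * R⁻¹ * X)ᵀ
        = Dmat n * R⁻¹ * (X * symplJ n * Xᵀ) * (R⁻¹ * Dmat n) := by
          simp only [transpose_mul, transpose_nonsing_inv, hR, Dmat_transpose, mul_assoc]
      _ = -(Dmat n * (R⁻¹ * R) * symplJ n * (R * R⁻¹) * Dmat n) := by
          rw [hXJ]; simp only [mul_assoc, mul_neg, neg_mul]
      _ = symplJ n := by
          rw [nonsing_inv_mul _ hdet, mul_nonsing_inv _ hdet, mul_one, mul_one,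
            Dmat_mul_symplJ_mul_Dmat, neg_neg]
  · calc X = R * (1 * R⁻¹) * X := by rw [one_mul, mul_nonsing_inv _ hdet, one_mul]
      _ = R * Dmat n * (Dmat n * R⁻¹ * X) := by
          rw [← Dmat_mul_self n]; simp only [mul_assoc]
end

section
/- Let X be a real 2n×2n matrix with det X ≠ 0. Then there exists a real symmetric matrix R (Rᵀ = R) and a real symplectic matrix S (S·J·Sᵀ = J) such that X = S·D·R, where D is the block diagonal matrix D = [[Iₙ, 0], [0, -Iₙ]]. -/
open Matrix

open Polynomial in
/-- A quotient `K[X] / (m)` by a monic polynomial is a Frobenius algebra: it carries a linear form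
whose associated bilinear form `(a, b) ↦ ℓ (a * b)` is nondegenerate. -/
theorem AdjoinRoot.exists_linearForm_separating {K : Type*} [Field K] {m : K[X]} (hm : m.Monic) :
    ∃ l : AdjoinRoot m →ₗ[K] K, ∀ a, (∀ b, l (a * b) = 0) → a = 0 := by
  refine ⟨(lcoeff K (m.natDegree - 1)).comp (AdjoinRoot.modByMonicHom hm), fun a ha => ?_⟩
  by_contra hne
  set p := AdjoinRoot.modByMonicHom hm a with hp
  have hap : AdjoinRoot.mk m p = a := AdjoinRoot.mk_leftInverse hm a
  have hp0 : p ≠ 0 := by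
    rintro h
    rw [h, map_zero] at hap
    exact hne hap.symm
  have hlt : p.degree < m.degree := by
    obtain ⟨q, rfl⟩ := AdjoinRoot.mk_surjective a
    rw [hp, AdjoinRoot.modByMonicHom_mk]
    exact degree_modByMonic_lt q hm
  have hnat : p.natDegree < m.natDegree := natDegree_lt_natDegree hp0 hlt
  have hsum : p.natDegree + (m.natDegree - 1 - p.natDegree) = m.natDegree - 1 := by omega
  have h := ha (AdjoinRoot.mk m (X ^ (m.natDegree - 1 - p.natDegree)))
  have hdeg : (p * X ^ (m.natDegree - 1 - p.natDegree)).degree < m.degree := by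
    apply degree_lt_degree
    rw [natDegree_mul_X_pow _ hp0, hsum]
    omega
  rw [← hap, ← map_mul, LinearMap.comp_apply, AdjoinRoot.modByMonicHom_mk,
    (modByMonic_eq_self_iff hm).2 hdeg, lcoeff_apply] at h
  nth_rewrite 2 [← hsum] at h
  rw [coeff_mul_X_pow] at h
  exact hp0 (leadingCoeff_eq_zero.1 h)

open Polynomial in
/-- An endomorphism of a finite-dimensional space has a vector whose annihilator is generated by
the minimal polynomial. -/
theorem Module.End.exists_vector_minpoly_dvd {K V : Type*} [Field K] [AddCommGroup V] [Module K V]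
    [FiniteDimensional K V] (T : Module.End K V) :
    ∃ v : V, ∀ p : K[X], aeval T p v = 0 → minpoly K T ∣ p := by
  obtain ⟨x, hx⟩ := Module.exists_ker_toSpanSingleton_eq_annihilator K[X] (Module.AEval' T)
  obtain ⟨v, rfl⟩ := (Module.AEval'.of T).surjective x
  refine ⟨v, fun p hp => ?_⟩
  rw [← span_minpoly_eq_annihilator] at hx
  rw [← Ideal.mem_span_singleton, ← hx, LinearMap.mem_ker, LinearMap.toSpanSingleton_apply]
  change p • Module.AEval.of K V T v = 0
  rw [← Module.AEval.of_aeval_smul]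
  simpa using! hp

namespace LinearMap.BilinForm

variable {K : Type*} [Field K]

/-- Skew-adjoint square roots on two complementary orthogonal subspaces glue. -/
theorem exists_skewAdjoint_sqrt_of_isCompl {V : Type*} [AddCommGroup V] [Module K V]
    {B : LinearMap.BilinForm K V} (hB : B.IsRefl) {T : Module.End K V} {U W : Submodule K V}
    (hUW : IsCompl U W) (hortho : ∀ x ∈ U, ∀ y ∈ W, B x y = 0)
    (hU : ∃ N : Module.End K U, (∀ x, (N (N x) : V) = T x) ∧
      ∀ x y : U, B (N x) y = -B x (N y))
    (hW : ∃ N : Module.End K W, (∀ x, (N (N x) : V) = T x) ∧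
      ∀ x y : W, B (N x) y = -B x (N y)) :
    ∃ N : Module.End K V, N * N = T ∧ ∀ x y, B (N x) y = -B x (N y) := by
  obtain ⟨M, hM, hM'⟩ := hU
  obtain ⟨N, hN, hN'⟩ := hW
  set e := Submodule.prodEquivOfIsCompl U W hUW
  have he : ∀ p : U × W, e p = (p.1 : V) + p.2 := fun p => rfl
  have h₁ : ∀ (x : U) (y : W), B x y = 0 := fun x y => hortho x x.2 y y.2
  have h₂ : ∀ (x : U) (y : W), B y x = 0 := fun x y => hB _ _ (h₁ x y)
  have hconj : ∀ p, e.conj (M.prodMap N) (e p) = e (M p.1, N p.2) := fun p => by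
    rw [LinearEquiv.conj_apply_apply, LinearEquiv.symm_apply_apply, LinearMap.prodMap_apply]
  refine ⟨e.conj (M.prodMap N), ?_, fun x y => ?_⟩
  · ext x
    obtain ⟨p, rfl⟩ := e.surjective x
    rw [Module.End.mul_apply, hconj, hconj, he, he, hM, hN, map_add]
  · obtain ⟨p, rfl⟩ := e.surjective x
    obtain ⟨q, rfl⟩ := e.surjective y
    rw [hconj, hconj]
    simp only [he, map_add, LinearMap.add_apply, h₁, h₂, hM', hN']
    ring

/-- Every endomorphism self-adjoint for a symplectic form has a skew-adjoint square root. -/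
theorem exists_skewAdjoint_sqrt_s4 [NeZero (2 : K)] {V : Type*} [AddCommGroup V] [Module K V]
    [FiniteDimensional K V] {B : LinearMap.BilinForm K V} (hB : B.IsAlt) (hnd : B.Nondegenerate)
    {T : Module.End K V} (hT : ∀ x y, B (T x) y = B x (T y)) :
    ∃ N : Module.End K V, N * N = T ∧ ∀ x y, B (N x) y = -B x (N y) := by
  induction hd : Module.finrank K V using Nat.strong_induction_on generalizing V with
  | _ d ih =>
  rcases subsingleton_or_nontrivial V with hV | hV
  · exact ⟨0, Subsingleton.elim _ _, by simp⟩
  have hmonic : (minpoly K T).Monic := minpoly.monic (Algebra.IsIntegral.isIntegral T)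
  let A := AdjoinRoot (minpoly K T)
  obtain ⟨l, hl⟩ := AdjoinRoot.exists_linearForm_separating hmonic
  let ρ : A →ₐ[K] Module.End K V :=
    Ideal.Quotient.liftₐ _ (Polynomial.aeval T) fun p hp => by
      obtain ⟨q, rfl⟩ := Ideal.mem_span_singleton.1 hp
      rw [map_mul, minpoly.aeval, zero_mul]
  have hρ : ∀ p, ρ (AdjoinRoot.mk _ p) = Polynomial.aeval T p := fun p => rfl
  have hroot : ρ (AdjoinRoot.root _) = T := (hρ Polynomial.X).trans (Polynomial.aeval_X T)
  have hadj : ∀ a x y, B (ρ a x) y = B x (ρ a y) := by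
    intro a x y
    obtain ⟨p, rfl⟩ := AdjoinRoot.mk_surjective a
    rw [hρ]
    induction p using Polynomial.induction_on' generalizing x y with
    | add p q hp hq => simp [hp, hq]
    | monomial n c =>
      simp only [Polynomial.aeval_monomial, Module.algebraMap_end_eq_smul_id, Module.End.mul_apply,
        LinearMap.smul_apply, LinearMap.id_apply, map_smul]
      congr 1
      induction n generalizing x y with
      | zero => simp
      | succ n ihn => rw [pow_succ, Module.End.mul_apply, ihn, hT, ← Module.End.mul_apply,
          ← pow_succ', pow_succ]
  have hmul : ∀ a b x, ρ a (ρ b x) = ρ (a * b) x := by simp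
  have hiso : ∀ a b x, B (ρ a x) (ρ b x) = 0 := by
    intro a b x
    have h : B (ρ a x) (ρ b x) = -B (ρ a x) (ρ b x) := by
      conv_lhs => rw [hadj, hmul, mul_comm, ← hmul, ← hadj, ← hB.neg_eq]
    have h2 : (2 : K) * B (ρ a x) (ρ b x) = 0 := by linear_combination h
    exact (mul_eq_zero.1 h2).resolve_left (NeZero.ne _)
  obtain ⟨v, hv⟩ := Module.End.exists_vector_minpoly_dvd T
  let orbit : V → A →ₗ[K] V := fun x => (LinearMap.applyₗ x).comp ρ.toLinearMap
  have horbit : ∀ x a, orbit x a = ρ a x := fun _ _ => rfl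
  have hvinj : LinearMap.ker (orbit v) = ⊥ := by
    rw [LinearMap.ker_eq_bot']
    intro a ha
    obtain ⟨p, rfl⟩ := AdjoinRoot.mk_surjective a
    exact AdjoinRoot.mk_eq_zero.2 (hv p ha)
  obtain ⟨g, hg⟩ := LinearMap.exists_leftInverse_of_injective _ hvinj
  obtain ⟨w, hw⟩ : ∃ w, ∀ a, B (ρ a v) w = l a := by
    refine ⟨-(B.toDual hnd).symm (l.comp g), fun a => ?_⟩
    have h := LinearMap.congr_fun hg a
    rw [map_neg, hB.neg_eq, apply_toDual_symm_apply, LinearMap.comp_apply, ← horbit]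
    exact congrArg l h
  have hvw : ∀ a b, B (ρ a v) (ρ b w) = l (a * b) := fun a b => by
    rw [← hadj, hmul, hw, mul_comm]
  have hwv : ∀ a b, B (ρ a w) (ρ b v) = -l (a * b) := fun a b => by
    rw [← hB.neg_eq, hvw, mul_comm]
  let f : A × A →ₗ[K] V := (orbit v).coprod (orbit w)
  have hf : ∀ p, f p = ρ p.1 v + ρ p.2 w := fun _ => rfl
  have hform : ∀ p q, B (f p) (f q) = l (p.1 * q.2) - l (p.2 * q.1) := fun p q => by
    simp only [hf, map_add, LinearMap.add_apply, hiso, hvw, hwv]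
    ring
  have hsep : ∀ p, (∀ q, B (f p) (f q) = 0) → p = 0 := fun p hp => by
    refine Prod.ext (hl _ fun b => ?_) (hl _ fun b => ?_)
    · simpa [hform] using hp (0, b)
    · simpa [hform] using hp (b, 0)
  have hfinj : Function.Injective f := by
    rw [← LinearMap.ker_eq_bot, LinearMap.ker_eq_bot']
    exact fun p hp => hsep p fun q => by rw [hp, map_zero, LinearMap.zero_apply]
  set U := LinearMap.range f with hUdef
  have hUT : ∀ p, T (f p) = f (AdjoinRoot.root _ * p.1, AdjoinRoot.root _ * p.2) := fun p => by
    simp only [hf, map_add, map_mul, hroot, Module.End.mul_apply]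
  have hdisj : Disjoint U (B.orthogonal U) := by
    rw [Submodule.disjoint_def]
    rintro _ ⟨p, rfl⟩ h
    rw [hsep p fun q => hB.isRefl _ _ (h (f q) ⟨q, rfl⟩), map_zero]
  have hcompl : IsCompl U (B.orthogonal U) := (isCompl_orthogonal_iff_disjoint hB.isRefl).2 hdisj
  refine exists_skewAdjoint_sqrt_of_isCompl hB.isRefl hcompl (fun x hx y hy => hy x hx) ?_ ?_
  · let e : (A × A) ≃ₗ[K] U := LinearEquiv.ofInjective f hfinj
    have he : ∀ p, (e p : V) = f p := fun _ => rfl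
    let M : Module.End K (A × A) :=
      ((LinearMap.mulLeft K (AdjoinRoot.root (minpoly K T))).comp (LinearMap.snd K A A)).prod
        (LinearMap.fst K A A)
    have hM : ∀ p, M p = (AdjoinRoot.root _ * p.2, p.1) := fun _ => rfl
    refine ⟨e.conj M, fun x => ?_, fun x y => ?_⟩
    · obtain ⟨p, rfl⟩ := e.surjective x
      simp [LinearEquiv.conj_apply, he, hM, hUT]
    · obtain ⟨p, rfl⟩ := e.surjective x
      obtain ⟨q, rfl⟩ := e.surjective y
      simp only [LinearEquiv.conj_apply, LinearMap.comp_apply, LinearEquiv.coe_coe,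
        LinearEquiv.symm_apply_apply, he, hM, hform, neg_sub]
      congr 2
      ring
  · have hWT : ∀ x ∈ B.orthogonal U, T x ∈ B.orthogonal U := by
      rintro x hx _ ⟨p, rfl⟩
      change B (f p) (T x) = 0
      rw [← hT, hUT]
      exact hx _ ⟨_, rfl⟩
    have hlt : Module.finrank K (B.orthogonal U) < d := by
      rw [← hd]
      refine Submodule.finrank_lt fun htop => ?_
      have hbot : U = ⊥ := by simpa [htop] using hdisj
      have hv0 : v = 0 := by
        have : f (1, 0) ∈ U := ⟨_, rfl⟩
        simpa [hbot, hf] using this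
      have hunit := hv 1 (by simp [hv0])
      exact minpoly.not_isUnit K T (isUnit_of_dvd_one hunit)
    have hndW : (B.restrict (B.orthogonal U)).Nondegenerate := by
      refine B.nondegenerate_restrict_of_disjoint_orthogonal hB.isRefl ?_
      rw [orthogonal_orthogonal hnd hB.isRefl]
      exact hdisj.symm
    obtain ⟨N, hN, hN'⟩ := ih _ hlt (V := B.orthogonal U) (B := B.restrict (B.orthogonal U))
      (fun x => hB x) hndW (T := T.restrict hWT) (fun x y => hT x y) rfl
    exact ⟨N, fun x => congrArg Subtype.val (LinearMap.congr_fun hN x), hN'⟩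

end LinearMap.BilinForm

/-- Every skew-Hamiltonian matrix has a Hamiltonian square root. -/
theorem exists_hamiltonian_sqrt (n : ℕ) {M : Matrix (Fin n ⊕ Fin n) (Fin n ⊕ Fin n) ℝ}
    (hM : Mᵀ * symplJ n = symplJ n * M) :
    ∃ N : Matrix (Fin n ⊕ Fin n) (Fin n ⊕ Fin n) ℝ,
      N * N = M ∧ Nᵀ * symplJ n = -(symplJ n * N) := by
  have hJ : symplJ n = Matrix.J (Fin n) ℝ := rfl
  have hB : ∀ x y, Matrix.toBilin' (symplJ n) x y = x ⬝ᵥ symplJ n *ᵥ y :=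
    fun x y => Matrix.toBilin'_apply' ..
  have hleft : ∀ (P : Matrix (Fin n ⊕ Fin n) (Fin n ⊕ Fin n) ℝ) x y,
      Matrix.toBilin' (symplJ n) (P *ᵥ x) y = x ⬝ᵥ (Pᵀ * symplJ n) *ᵥ y := fun P x y => by
    rw [hB, ← Matrix.mulVec_mulVec, Matrix.dotProduct_mulVec x, Matrix.vecMul_transpose]
  have halt : (Matrix.toBilin' (symplJ n)).IsAlt := fun x => by
    have h : x ⬝ᵥ symplJ n *ᵥ x = -(x ⬝ᵥ symplJ n *ᵥ x) := by
      conv_lhs => rw [Matrix.dotProduct_mulVec, ← Matrix.mulVec_transpose, dotProduct_comm,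
        hJ, Matrix.J_transpose, Matrix.neg_mulVec, dotProduct_neg, ← hJ]
    rw [hB]
    linarith
  have hnd : (Matrix.toBilin' (symplJ n)).Nondegenerate :=
    LinearMap.BilinForm.nondegenerate_toBilin'_of_det_ne_zero' _
      (hJ ▸ (Matrix.isUnit_det_J (Fin n) ℝ).ne_zero)
  obtain ⟨N, hN, hN'⟩ := LinearMap.BilinForm.exists_skewAdjoint_sqrt_s4 halt hnd
    (T := Matrix.toLin' M) (fun x y => by
      rw [Matrix.toLin'_apply, Matrix.toLin'_apply, hleft, hM, hB, Matrix.mulVec_mulVec])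
  refine ⟨LinearMap.toMatrix' N, ?_, ?_⟩
  · rw [← LinearMap.toMatrix'_mul, hN, LinearMap.toMatrix'_toLin']
  · refine Matrix.toBilin'.injective (LinearMap.ext₂ fun x y => ?_)
    rw [Matrix.toBilin'_apply', Matrix.toBilin'_apply', ← hleft, LinearMap.toMatrix'_mulVec, hN',
      hB, Matrix.neg_mulVec, dotProduct_neg, ← Matrix.mulVec_mulVec, LinearMap.toMatrix'_mulVec]

/-- Corollary: a nondegenerate `X` factors as `X = S * D * R` with `R` symmetric and `S` symplectic. -/
theorem stmt_4 (n : ℕ) (X : Matrix (Fin n ⊕ Fin n) (Fin n ⊕ Fin n) ℝ)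
    (hX : X.det ≠ 0) :
    ∃ R S : Matrix (Fin n ⊕ Fin n) (Fin n ⊕ Fin n) ℝ,
      Rᵀ = R ∧ S * symplJ n * Sᵀ = symplJ n ∧ X = S * Dmat n * R := by
  have hJT : (symplJ n)ᵀ = -symplJ n := Matrix.J_transpose (Fin n) ℝ
  have hJJ : symplJ n * symplJ n = -1 := Matrix.J_squared (Fin n) ℝ
  have hJJ' : ∀ P, symplJ n * (symplJ n * P) = -P := fun P => by
    rw [← Matrix.mul_assoc, hJJ, neg_one_mul]
  have hDT : (Dmat n)ᵀ = Dmat n := by simp [Dmat, Matrix.fromBlocks_transpose]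
  have hDD : Dmat n * Dmat n = 1 := by simp [Dmat, Matrix.fromBlocks_multiply]
  have hDJD : Dmat n * symplJ n * Dmat n = -symplJ n := by
    simp [Dmat, symplJ, Matrix.fromBlocks_multiply, Matrix.fromBlocks_neg]
  obtain ⟨N, hN, hN'⟩ := exists_hamiltonian_sqrt n (M := -(symplJ n * (Xᵀ * symplJ n * X))) (by
    simp [Matrix.transpose_mul, hJT, hJJ, hJJ', Matrix.mul_assoc])
  set R := symplJ n * N with hRdef
  have hR : Rᵀ = R := by
    rw [Matrix.transpose_mul, hJT, Matrix.mul_neg, hN', neg_neg]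
  have hRJR : R * symplJ n * R = -(Xᵀ * symplJ n * X) := by
    calc R * symplJ n * R = -(symplJ n * (N * N)) := by
          simp [hRdef, Matrix.mul_assoc, hJJ']
      _ = _ := by rw [hN, Matrix.mul_neg, hJJ', neg_neg]
  have hRdet : IsUnit R.det := by
    refine isUnit_iff_ne_zero.2 fun h0 => ?_
    have h : Xᵀ * symplJ n * X = R * symplJ n * (-R) := by rw [Matrix.mul_neg, hRJR, neg_neg]
    have h' := congrArg Matrix.det h
    have hJdet : (symplJ n).det ≠ 0 := (Matrix.isUnit_det_J (Fin n) ℝ).ne_zero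
    rw [Matrix.det_mul, Matrix.det_mul, Matrix.det_mul, Matrix.det_mul, h0, zero_mul, zero_mul,
      Matrix.det_transpose] at h'
    exact mul_ne_zero (mul_ne_zero hX hJdet) hX h'
  refine ⟨R, X * R⁻¹ * Dmat n, hR, ?_, ?_⟩
  · refine SymplecticGroup.mem_iff.1 (SymplecticGroup.mem_iff'.2 ?_)
    change (X * R⁻¹ * Dmat n)ᵀ * symplJ n * (X * R⁻¹ * Dmat n) = symplJ n
    calc (X * R⁻¹ * Dmat n)ᵀ * symplJ n * (X * R⁻¹ * Dmat n)
        = Dmat n * (R⁻¹ * (Xᵀ * symplJ n * X) * R⁻¹) * Dmat n := by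
          simp only [Matrix.transpose_mul, Matrix.transpose_nonsing_inv, hR, hDT, Matrix.mul_assoc]
      _ = -(Dmat n * ((R⁻¹ * R) * symplJ n * (R * R⁻¹)) * Dmat n) := by
          rw [← neg_neg (Xᵀ * symplJ n * X), ← hRJR]
          simp only [Matrix.mul_neg, Matrix.neg_mul, Matrix.mul_assoc]
      _ = symplJ n := by
          rw [Matrix.nonsing_inv_mul _ hRdet, Matrix.mul_nonsing_inv _ hRdet, Matrix.one_mul,
            Matrix.mul_one, hDJD, neg_neg]
  · rw [Matrix.mul_assoc (X * R⁻¹), hDD, Matrix.mul_one, Matrix.mul_assoc,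
      Matrix.nonsing_inv_mul _ hRdet, Matrix.mul_one]
end
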